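/- Let A, B and C be nontrivial finitely generated groups. If A and B are quasi-isometric, then the free products A*C and B*C are quasi-isometric, unless C, and one of A or B, are of order 2. -/

import Mathlib

/-- Word distance on a group w.r.t. a generating set `S`. -/
noncomputable def wordDist {G : Type*} [Group G] (S : Set G) (g h : G) : ℕ :=
  sInf {n | ∃ l : List G, l.length = n ∧ (∀ x ∈ l, x ∈ S ∨ x⁻¹ ∈ S) ∧ l.prod = g⁻¹ * h}

/-- `f` is a `(K, C)`-quasi-isometric embedding between the "metric spaces"
given by the distance functions `dX` and `dY`. -/
def IsQIEmbedding (K C : ℝ) {X Y : Type*} (dX : X → X → ℝ) (dY : Y → Y → ℝ)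
    (f : X → Y) : Prop :=
  ∀ a b : X, (1 / K) * dX a b - C ≤ dY (f a) (f b) ∧ dY (f a) (f b) ≤ K * dX a b + C

/-- `f` is a `(K, C)`-quasi-isometry between the "metric spaces" given by the
distance functions `dX` and `dY`: a quasi-isometric embedding with `C`-coarsely
dense image. -/
def IsQuasiIsometry (K C : ℝ) {X Y : Type*} (dX : X → X → ℝ) (dY : Y → Y → ℝ)
    (f : X → Y) : Prop :=
  IsQIEmbedding K C dX dY f ∧ ∀ y : Y, ∃ a : X, dY (f a) y ≤ C

/-- Two groups are quasi-isometric if they have finite generating sets for which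
the word metrics admit a quasi-isometry between them (this is independent of the
choice of finite generating sets). -/
def QuasiIsometricGroups (G H : Type*) [Group G] [Group H] : Prop :=
  ∃ (S : Finset G) (T : Finset H), Subgroup.closure (S : Set G) = ⊤ ∧
    Subgroup.closure (T : Set H) = ⊤ ∧
    ∃ (K C : ℝ) (f : G → H), 0 < K ∧ 0 ≤ C ∧
      IsQuasiIsometry K C (fun a b => (wordDist (S : Set G) a b : ℝ))
        (fun a b => (wordDist (T : Set H) a b : ℝ)) f


section WordMetric

variable {G H : Type*} [Group G] [Group H] {S : Set G} {T : Set H}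

theorem exists_list_wordDist (hS : Subgroup.closure S = ⊤) (g h : G) :
    ∃ l : List G, l.length = wordDist S g h ∧ (∀ x ∈ l, x ∈ S ∨ x⁻¹ ∈ S) ∧
      l.prod = g⁻¹ * h := by
  have hmem : g⁻¹ * h ∈ Subgroup.closure S := hS ▸ Subgroup.mem_top _
  rw [← Subgroup.mem_toSubmonoid, Subgroup.closure_toSubmonoid] at hmem
  obtain ⟨l, hl, hp⟩ := Submonoid.exists_list_of_mem_closure hmem
  have : (wordDist S g h) ∈ {n | ∃ l : List G, l.length = n ∧
      (∀ x ∈ l, x ∈ S ∨ x⁻¹ ∈ S) ∧ l.prod = g⁻¹ * h} :=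
    Nat.sInf_mem ⟨l.length, l, rfl, hl, hp⟩
  exact this

theorem wordDist_le_length {g h : G} {l : List G} (hl : ∀ x ∈ l, x ∈ S ∨ x⁻¹ ∈ S)
    (hp : l.prod = g⁻¹ * h) : wordDist S g h ≤ l.length :=
  Nat.sInf_le ⟨l, rfl, hl, hp⟩

theorem wordDist_self (g : G) : wordDist S g g = 0 := by
  simpa using wordDist_le_length (S := S) (g := g) (h := g) (l := []) (by simp) (by simp)

theorem wordDist_mul_left (k g h : G) : wordDist S (k * g) (k * h) = wordDist S g h := by
  simp [wordDist, mul_assoc]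

theorem wordDist_mul_right_self (g h : G) : wordDist S g (g * h) = wordDist S 1 h := by
  simpa using wordDist_mul_left (S := S) g 1 h

theorem wordDist_mul_le_one (g : G) {s : G} (hs : s ∈ S) : wordDist S g (g * s) ≤ 1 := by
  simpa using wordDist_le_length (S := S) (g := g) (h := g * s) (l := [s])
    (by simp [hs]) (by simp)

theorem wordDist_triangle (hS : Subgroup.closure S = ⊤) (x y z : G) :
    wordDist S x z ≤ wordDist S x y + wordDist S y z := by
  obtain ⟨l, hl, hl1, hl2⟩ := exists_list_wordDist hS x y
  obtain ⟨m, hm, hm1, hm2⟩ := exists_list_wordDist hS y z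
  rw [← hl, ← hm, ← List.length_append]
  refine wordDist_le_length (fun x hx => ?_) (by simp [hl2, hm2, mul_assoc])
  rcases List.mem_append.1 hx with h | h
  exacts [hl1 x h, hm1 x h]

theorem wordDist_comm_le (hS : Subgroup.closure S = ⊤) (x y : G) :
    wordDist S x y ≤ wordDist S y x := by
  obtain ⟨l, hl, hl1, hl2⟩ := exists_list_wordDist hS y x
  have : (l.map (·⁻¹)).reverse.length = wordDist S y x := by simp [hl]
  rw [← this]
  refine wordDist_le_length (fun z hz => ?_) ?_
  · simp only [List.mem_reverse, List.mem_map] at hz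
    obtain ⟨w, hw, rfl⟩ := hz
    simpa [or_comm] using hl1 w hw
  · rw [← List.prod_inv_reverse, hl2]
    simp

theorem wordDist_comm (hS : Subgroup.closure S = ⊤) (x y : G) :
    wordDist S x y = wordDist S y x :=
  le_antisymm (wordDist_comm_le hS x y) (wordDist_comm_le hS y x)

/-- A map moving generator steps by at most `K` is `K`-Lipschitz. -/
theorem wordDist_le_mul_of_generators (hS : Subgroup.closure S = ⊤)
    (hT : Subgroup.closure T = ⊤) {f : G → H} {K : ℕ}
    (hf : ∀ x, ∀ s ∈ S, wordDist T (f x) (f (x * s)) ≤ K) (x y : G) :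
    wordDist T (f x) (f y) ≤ K * wordDist S x y := by
  obtain ⟨l, hl, hl1, hl2⟩ := exists_list_wordDist hS x y
  rw [← hl]
  obtain rfl : y = x * l.prod := by rw [hl2]; group
  clear hl hl2
  induction l generalizing x with
  | nil => simp [wordDist_self]
  | cons a l ih =>
    have h1 : wordDist T (f x) (f (x * a)) ≤ K := by
      rcases hl1 a (by simp) with h | h
      · exact hf x a h
      · have := hf (x * a) _ h
        rw [wordDist_comm hT]
        simpa using this
    have h2 := ih (x * a) (fun z hz => hl1 z (by simp [hz]))
    have h3 := wordDist_triangle hT (f x) (f (x * a)) (f (x * a * l.prod))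
    simp only [List.prod_cons, List.length_cons, ← mul_assoc]
    rw [mul_add, mul_one]
    omega

theorem wordDist_map_le (hS : Subgroup.closure S = ⊤) (hT : Subgroup.closure T = ⊤)
    (φ : G →* H) (hφ : ∀ s ∈ S, φ s ∈ T) (x y : G) :
    wordDist T (φ x) (φ y) ≤ wordDist S x y := by
  have := wordDist_le_mul_of_generators hS hT (f := φ) (K := 1)
    (fun x s hs => by rw [map_mul]; exact wordDist_mul_le_one _ (hφ s hs)) x y
  simpa using this

theorem finite_wordDist_le (hS : Subgroup.closure S = ⊤) (hfin : S.Finite) (n : ℕ) :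
    {g : G | wordDist S 1 g ≤ n}.Finite := by
  have hU : (S ∪ S⁻¹).Finite := hfin.union hfin.inv
  have := hU.to_subtype
  refine ((List.finite_length_le ↥(S ∪ S⁻¹) n).image
    (fun l => (l.map Subtype.val).prod)).subset ?_
  intro g hg
  obtain ⟨l, hl, hl1, hl2⟩ := exists_list_wordDist hS 1 g
  lift l to List ↥(S ∪ S⁻¹) using fun x hx => by simpa using hl1 x hx
  rw [List.length_map] at hl
  exact ⟨l, hl.trans_le hg, by simpa using hl2⟩

/-- Points of a set of bounded diameter: at most `N` of them. -/
theorem exists_ncard_bound (hS : Subgroup.closure S = ⊤) (hfin : S.Finite) (n : ℕ) :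
    ∃ N : ℕ, ∀ s : Set G, (∀ x ∈ s, ∀ y ∈ s, wordDist S x y ≤ n) → s.Finite ∧ s.ncard ≤ N := by
  have hB := finite_wordDist_le hS hfin n
  refine ⟨{g : G | wordDist S 1 g ≤ n}.ncard, fun s hs => ?_⟩
  rcases s.eq_empty_or_nonempty with rfl | ⟨x, hx⟩
  · simp
  · have hsub : s ⊆ (x * ·) '' {g : G | wordDist S 1 g ≤ n} := fun y hy =>
      ⟨x⁻¹ * y, by
        have := hs x hx y hy
        rw [← wordDist_mul_left x⁻¹] at this
        simpa using this, by simp⟩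
    exact ⟨(hB.image _).subset hsub,
      (Set.ncard_le_ncard hsub (hB.image _)).trans (Set.ncard_image_le hB)⟩

/-- König's lemma: an infinite finitely generated group contains a geodesic ray. -/
theorem exists_geodesic_ray [Infinite G] (hS : Subgroup.closure S = ⊤) (hfin : S.Finite) :
    ∃ r : ℕ → G, ∀ n, wordDist S 1 (r n) = n ∧ wordDist S (r n) (r (n + 1)) ≤ 1 := by
  have hU : (S ∪ S⁻¹).Finite := hfin.union hfin.inv
  have := hU.to_subtype
  let ev : List ↥(S ∪ S⁻¹) → G := fun l => (l.map Subtype.val).prod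
  have hev (l) (g : G) : wordDist S g (g * ev l) ≤ l.length := by
    have : (l.map Subtype.val).length = l.length := by simp
    rw [← this]
    refine wordDist_le_length (fun x hx => ?_) (by simp [ev])
    obtain ⟨y, -, rfl⟩ := List.mem_map.1 hx
    exact y.2
  have hlist (g : G) : ∃ l, ev l = g ∧ l.length = wordDist S 1 g := by
    obtain ⟨l, hl, hl1, hl2⟩ := exists_list_wordDist hS 1 g
    lift l to List ↥(S ∪ S⁻¹) using fun x hx => by simpa using hl1 x hx
    exact ⟨l, hl2.trans (by simp), by simpa using hl⟩
  have hsplit (l) (i : ℕ) : ev l = ev (l.take i) * ev (l.drop i) := by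
    simp only [ev]
    rw [← List.prod_append, ← List.map_append, List.take_append_drop]
  have htake (l) (hl : wordDist S 1 (ev l) = l.length) (i : ℕ) (hi : i ≤ l.length) :
      wordDist S 1 (ev (l.take i)) = i := by
    have h1 := hev (l.take i) 1
    have h2 := hev (l.drop i) (ev (l.take i))
    rw [← hsplit] at h2
    have h3 := wordDist_triangle hS 1 (ev (l.take i)) (ev l)
    simp only [List.length_take, List.length_drop, one_mul] at h1 h2
    omega
  let α : ℕ → Type _ := fun n =>
    {l : List ↥(S ∪ S⁻¹) // l.length = n ∧ wordDist S 1 (ev l) = n}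
  have hne : ∀ n, Nonempty (α n) := by
    intro n
    obtain ⟨g, hg⟩ : ∃ g, n ≤ wordDist S 1 g := by
      by_contra! hcon
      exact Set.infinite_univ ((finite_wordDist_le hS hfin n).subset fun g _ => (hcon g).le)
    obtain ⟨l, rfl, hl⟩ := hlist g
    exact ⟨⟨l.take n, by simp; omega, htake l hl.symm n (by omega)⟩⟩
  have hF : ∀ n, Finite (α n) := fun n =>
    ((List.finite_length_eq ↥(S ∪ S⁻¹) n).subset (fun l hl => hl.1 :
      {l : List ↥(S ∪ S⁻¹) | l.length = n ∧ wordDist S 1 (ev l) = n} ⊆ _)).to_subtype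
  obtain ⟨f, hf⟩ := exists_seq_forall_proj_of_forall_finite (α := α)
    (fun {i j} hij l => ⟨l.1.take i, by simp [l.2.1, hij],
      htake l.1 (l.2.2.trans l.2.1.symm) i (by omega)⟩)
    (fun i l => Subtype.ext (by simp [List.take_of_length_le l.2.1.le]))
    (fun i j k hij hjk l => Subtype.ext (by simp [List.take_take, hij]))
    (fun i a => Set.toFinite _)
  refine ⟨fun n => ev (f n).1, fun n => ⟨(f n).2.2, ?_⟩⟩
  have h1 : (f (n + 1)).1.take n = (f n).1 := congrArg Subtype.val (hf (Nat.le_add_right n 1))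
  have h2 := hev ((f (n + 1)).1.drop n) (ev (f n).1)
  rw [← h1, ← hsplit] at h2
  beta_reduce
  rw [← h1]
  simpa [(f (n + 1)).2.1] using h2

end WordMetric

section CoarseEquivalence

variable {G H L : Type*} [Group G] [Group H] [Group L] {S : Set G} {T : Set H} {U : Set L}

/-- Existence of Lipschitz maps in both directions that are inverse up to bounded error. -/
def CoarselyEquivalent (S : Set G) (T : Set H) : Prop :=
  ∃ (f : G → H) (g : H → G) (K : ℕ),
    (∀ x y, wordDist T (f x) (f y) ≤ K * wordDist S x y) ∧
    (∀ x y, wordDist S (g x) (g y) ≤ K * wordDist T x y) ∧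
    (∀ x, wordDist S (g (f x)) x ≤ K) ∧ ∀ y, wordDist T (f (g y)) y ≤ K

theorem CoarselyEquivalent.symm (h : CoarselyEquivalent S T) : CoarselyEquivalent T S := by
  obtain ⟨f, g, K, h1, h2, h3, h4⟩ := h
  exact ⟨g, f, K, h2, h1, h4, h3⟩

theorem CoarselyEquivalent.trans (hS : Subgroup.closure S = ⊤) (hU : Subgroup.closure U = ⊤)
    (h : CoarselyEquivalent S T) (h' : CoarselyEquivalent T U) : CoarselyEquivalent S U := by
  obtain ⟨f, g, K, h1, h2, h3, h4⟩ := h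
  obtain ⟨f', g', K', h1', h2', h3', h4'⟩ := h'
  refine ⟨f' ∘ f, g ∘ g', K * K' + K + K', fun x y => ?_, fun x y => ?_, fun x => ?_, fun y => ?_⟩
  · have := (h1' (f x) (f y)).trans (Nat.mul_le_mul_left K' (h1 x y))
    simp only [Function.comp]
    nlinarith [Nat.zero_le (K * wordDist S x y), Nat.zero_le (K' * wordDist S x y)]
  · have := (h2 (g' x) (g' y)).trans (Nat.mul_le_mul_left K (h2' x y))
    simp only [Function.comp]
    nlinarith [Nat.zero_le (K * wordDist U x y), Nat.zero_le (K' * wordDist U x y)]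
  · have e1 := wordDist_triangle hS (g (g' (f' (f x)))) (g (f x)) x
    have e2 := (h2 (g' (f' (f x))) (f x)).trans (Nat.mul_le_mul_left K (h3' (f x)))
    have e3 := h3 x
    simp only [Function.comp]
    omega
  · have e1 := wordDist_triangle hU (f' (f (g (g' y)))) (f' (g' y)) y
    have e2 := (h1' (f (g (g' y))) (g' y)).trans (Nat.mul_le_mul_left K' (h4 (g' y)))
    have e3 := h4' y
    simp only [Function.comp]
    rw [mul_comm K' K] at e2
    omega

theorem CoarselyEquivalent.quasiIsometricGroups {S : Finset G} {T : Finset H}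
    (hS : Subgroup.closure (S : Set G) = ⊤) (hT : Subgroup.closure (T : Set H) = ⊤)
    (h : CoarselyEquivalent (S : Set G) (T : Set H)) : QuasiIsometricGroups G H := by
  obtain ⟨f, g, K, h1, h2, h3, h4⟩ := h
  refine ⟨S, T, hS, hT, K + 1, K + 2, f, by positivity, by positivity, fun a b => ⟨?_, ?_⟩,
    fun y => ⟨g y, ?_⟩⟩
  · have e1 := wordDist_triangle hS a (g (f a)) b
    have e2 := wordDist_triangle hS (g (f a)) (g (f b)) b
    have e3 := h3 a
    rw [wordDist_comm hS] at e3
    have e4 := h3 b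
    have e5 := h2 (f a) (f b)
    have e6 : wordDist (S : Set G) a b ≤ 2 * K + K * wordDist (T : Set H) (f a) (f b) := by omega
    have e7 : (wordDist (S : Set G) a b : ℝ) ≤
        2 * K + K * wordDist (T : Set H) (f a) (f b) := by exact_mod_cast e6
    have hK : (0 : ℝ) < K + 1 := by positivity
    rw [sub_le_iff_le_add, one_div, inv_mul_le_iff₀ hK]
    nlinarith [Nat.cast_nonneg (α := ℝ) (wordDist (T : Set H) (f a) (f b)),
      Nat.cast_nonneg (α := ℝ) K, mul_nonneg (Nat.cast_nonneg (α := ℝ) K)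
      (Nat.cast_nonneg (α := ℝ) K)]
  · have e : (wordDist (T : Set H) (f a) (f b) : ℝ) ≤ K * wordDist (S : Set G) a b := by
      exact_mod_cast h1 a b
    have := Nat.cast_nonneg (α := ℝ) (wordDist (S : Set G) a b)
    have := Nat.cast_nonneg (α := ℝ) K
    simp only
    nlinarith
  · have e : (wordDist (T : Set H) (f (g y)) y : ℝ) ≤ K := by exact_mod_cast h4 y
    simp only
    linarith

end CoarseEquivalence

section NormalForm

open Monoid.Coprod

/-- Alternating words: an initial letter in `T`, then letters in `I`, the last one outermost. -/
inductive AltWord (T I : Type*) : Type _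
  | top (a : T) : AltWord T I
  | child (v : AltWord T I) (i : I) : AltWord T I

/-- The letters `c * a` with `c ≠ 1` and `a ≠ 1` from which a free product is built. -/
abbrev Letter (A C : Type*) [Group A] [Group C] : Type _ := {c : C // c ≠ 1} × {a : A // a ≠ 1}

/-- Representatives of the cosets of the factor `C` in the free product of `A` and `C`. -/
abbrev CosetRep (A C : Type*) [Group A] [Group C] : Type _ := AltWord A (Letter A C)

variable {A C : Type*} [Group A] [Group C]

/-- The element of the free product spelled by a letter. -/
def Letter.eval (i : Letter A C) : Monoid.Coprod A C := inr i.1.1 * inl i.2.1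

/-- The element of the free product spelled by an alternating word. -/
def CosetRep.eval : CosetRep A C → Monoid.Coprod A C
  | .top a => inl a
  | .child v i => CosetRep.eval v * Letter.eval i

/-- The element of the free product with given normal form. -/
def evalNF (x : CosetRep A C × C) : Monoid.Coprod A C := x.1.eval * inr x.2

/-- Representatives of the cosets of the factor `A`. -/
abbrev BlockRep (A C : Type*) [Group A] [Group C] : Type _ :=
  Option (CosetRep A C × {c : C // c ≠ 1})

/-- The element of the free product at the base of a coset of `A`. -/
def BlockRep.eval : BlockRep A C → Monoid.Coprod A C
  | none => 1
  | some (v, c) => v.eval * inr c.1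

open Classical in
/-- The normal form of the element of a coset of `A` with given `A`-coordinate. -/
noncomputable def blockPoint : BlockRep A C → A → CosetRep A C × C
  | none, a => (.top a, 1)
  | some (v, c), a => if h : a = 1 then (v, c.1) else (.child v (c, ⟨a, h⟩), 1)

theorem evalNF_blockPoint (q : BlockRep A C) (a : A) :
    evalNF (blockPoint q a) = q.eval * inl a := by
  rcases q with _ | ⟨v, c⟩
  · simp [blockPoint, evalNF, BlockRep.eval, CosetRep.eval]
  · by_cases h : a = 1
    · simp [blockPoint, evalNF, BlockRep.eval, h]
    · simp [blockPoint, evalNF, BlockRep.eval, h, CosetRep.eval, Letter.eval, mul_assoc]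

open Classical in
/-- The coset of `A` containing a normal form, and the `A`-coordinate in it. -/
noncomputable def blockCoord (x : CosetRep A C × C) : BlockRep A C × A :=
  if h : x.2 = 1 then
    match x.1 with
    | .top a => (none, a)
    | .child v i => (some (v, i.1), i.2.1)
  else (some (x.1, ⟨x.2, h⟩), 1)

/-- Each element lies in exactly one coset of `A`. -/
noncomputable def blockEquiv : BlockRep A C × A ≃ CosetRep A C × C where
  toFun x := blockPoint x.1 x.2
  invFun := blockCoord
  left_inv := by
    rintro ⟨_ | ⟨v, c, hc⟩, a⟩
    · simp [blockPoint, blockCoord]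
    · by_cases h : a = 1
      · simp [blockPoint, blockCoord, h, hc]
      · simp [blockPoint, blockCoord, h]
  right_inv := by
    rintro ⟨v, c⟩
    by_cases h : c = 1
    · subst h
      rcases v with a | ⟨v, c, a, ha⟩
      · simp [blockPoint, blockCoord]
      · simp [blockPoint, blockCoord, ha]
    · simp [blockPoint, blockCoord, h]

theorem evalNF_mul_inr (v : CosetRep A C) (c s : C) :
    evalNF (v, c) * inr s = evalNF (v, c * s) := by
  simp [evalNF, mul_assoc]

theorem evalNF_mul_inl (q : BlockRep A C) (a s : A) :
    evalNF (blockEquiv (q, a)) * inl s = evalNF (blockEquiv (q, a * s)) := by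
  simp [blockEquiv, evalNF_blockPoint, mul_assoc]

variable (A C) in
/-- Right translation of the `A`-coordinate. -/
noncomputable def rightShiftLeft :
    A →* (Equiv.Perm (CosetRep A C × C))ᵐᵒᵖ where
  toFun s := .op (blockEquiv.permCongr ((Equiv.refl _).prodCongr (Equiv.mulRight s)))
  map_one' := by
    apply MulOpposite.unop_injective
    ext1 x
    simp
  map_mul' s t := by
    apply MulOpposite.unop_injective
    ext1 x
    simp [Prod.map, mul_assoc]

variable (A C) in
/-- Right translation of the `C`-coordinate. -/
def rightShiftRight :
    C →* (Equiv.Perm (CosetRep A C × C))ᵐᵒᵖ where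
  toFun s := .op ((Equiv.refl _).prodCongr (Equiv.mulRight s))
  map_one' := by
    apply MulOpposite.unop_injective
    ext1 x
    simp
  map_mul' s t := by
    apply MulOpposite.unop_injective
    ext1 x
    simp [Prod.map, mul_assoc]

variable (A C) in
/-- The right action of the free product on normal forms. -/
noncomputable def rightAction :
    Monoid.Coprod A C →* (Equiv.Perm (CosetRep A C × C))ᵐᵒᵖ :=
  lift (rightShiftLeft A C) (rightShiftRight A C)

theorem rightAction_inl (q : BlockRep A C) (a s : A) :
    (rightAction A C (inl s)).unop (blockPoint q a) = blockPoint q (a * s) := by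
  have : blockPoint q a = blockEquiv (q, a) := rfl
  rw [this]
  simp [rightAction, rightShiftLeft]
  rfl

theorem rightAction_inr (v : CosetRep A C) (c s : C) :
    (rightAction A C (inr s)).unop (v, c) = (v, c * s) := by
  simp [rightAction, rightShiftRight]

theorem rightAction_mul (x y : Monoid.Coprod A C) (z : CosetRep A C × C) :
    (rightAction A C (x * y)).unop z =
      (rightAction A C y).unop ((rightAction A C x).unop z) := by
  simp

theorem rightAction_eval (v : CosetRep A C) :
    (rightAction A C v.eval).unop (.top 1, 1) = (v, 1) := by
  induction v with
  | top a => simpa [CosetRep.eval, blockPoint] using rightAction_inl (none : BlockRep A C) 1 a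
  | child v i ih =>
    obtain ⟨c, a, ha⟩ := i
    have h1 := rightAction_inl (some (v, c)) 1 a
    simp only [blockPoint, one_mul, ha, dite_true, dite_false] at h1
    simp only [CosetRep.eval, Letter.eval, rightAction_mul, ih, rightAction_inr, one_mul, h1]

theorem evalNF_injective : Function.Injective (evalNF (A := A) (C := C)) := by
  refine Function.LeftInverse.injective
    (g := fun x => (rightAction A C x).unop (.top 1, 1)) ?_
  rintro ⟨v, c⟩
  simp only [evalNF, rightAction_mul, rightAction_eval, rightAction_inr, one_mul]

theorem evalNF_surjective : Function.Surjective (evalNF (A := A) (C := C)) := by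
  have key (x : Monoid.Coprod A C) : ∀ n, ∃ m, evalNF m = evalNF (A := A) (C := C) n * x := by
    induction x using Monoid.Coprod.induction_on with
    | inl a =>
      intro n
      obtain ⟨⟨q, b⟩, rfl⟩ := blockEquiv.surjective n
      exact ⟨_, (evalNF_mul_inl q b a).symm⟩
    | inr c => exact fun n => ⟨_, (evalNF_mul_inr n.1 n.2 c).symm⟩
    | mul x y hx hy =>
      intro n
      obtain ⟨m, hm⟩ := hx n
      obtain ⟨k, hk⟩ := hy m
      exact ⟨k, by rw [hk, hm, mul_assoc]⟩
  intro x
  obtain ⟨m, hm⟩ := key x (.top 1, 1)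
  exact ⟨m, by simpa [evalNF, CosetRep.eval] using hm⟩

variable (A C) in
/-- The normal form bijection of a free product. -/
noncomputable def normalForm :
    CosetRep A C × C ≃ Monoid.Coprod A C :=
  Equiv.ofBijective evalNF ⟨evalNF_injective, evalNF_surjective⟩

/-- The union of generating sets of the factors, in the free product. -/
def coprodGens (S : Set A) (R : Set C) : Set (Monoid.Coprod A C) := inl '' S ∪ inr '' R

theorem closure_coprodGens {S : Set A} {R : Set C} (hS : Subgroup.closure S = ⊤)
    (hR : Subgroup.closure R = ⊤) : Subgroup.closure (coprodGens S R) = ⊤ := by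
  rw [coprodGens, Subgroup.closure_union, ← MonoidHom.map_closure, ← MonoidHom.map_closure, hS, hR,
    ← MonoidHom.range_eq_map, ← MonoidHom.range_eq_map, range_inl_sup_range_inr]

end NormalForm

section Hotel

/-- An enumeration of the fibres of `h` by initial segments of `ℕ`: the fibre over `y` consists of
the `el y i` with `i < cnt y`. -/
structure FiberEnum {X Y : Type*} (h : X → Y) where
  rank : X → ℕ
  cnt : Y → ℕ
  el : Y → ℕ → X
  cnt_pos : ∀ y, 0 < cnt y
  rank_lt : ∀ x, rank x < cnt (h x)
  map_el : ∀ y i, i < cnt y → h (el y i) = y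
  rank_el : ∀ y i, i < cnt y → rank (el y i) = i
  el_rank : ∀ x, el (h x) (rank x) = x

theorem exists_fiberEnum {X Y : Type*} {h : X → Y} (hs : Function.Surjective h) {N : ℕ}
    (hN : ∀ y, (h ⁻¹' {y}).Finite ∧ (h ⁻¹' {y}).ncard ≤ N) :
    ∃ E : FiberEnum h, ∀ y, E.cnt y ≤ N := by
  have hfin (y) : Finite (h ⁻¹' {y}) := (hN y).1.to_subtype
  let e (y) : (h ⁻¹' {y} : Set X) ≃ Fin (Nat.card (h ⁻¹' {y})) := Finite.equivFin _
  have hel (y) (i) (hi : i < Nat.card (h ⁻¹' {y})) : h ((e y).symm ⟨i, hi⟩).1 = y :=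
    ((e y).symm ⟨i, hi⟩).2
  have hrank (x : X) (y) (hx : h x = y) : e (h x) ⟨x, rfl⟩ = (e y ⟨x, hx⟩ : ℕ) := by
    subst hx; rfl
  have hex (y) : ∃ g : ℕ → X, ∀ i (hi : i < Nat.card (h ⁻¹' {y})),
      g i = ((e y).symm ⟨i, hi⟩).1 := by
    obtain ⟨x, -⟩ := hs y
    exact ⟨fun i => if hi : i < Nat.card (h ⁻¹' {y}) then ((e y).symm ⟨i, hi⟩).1 else x,
      fun i hi => by simp only [hi, dite_true]⟩
  choose el hel' using hex
  have hmap (y) (i) (hi : i < Nat.card (h ⁻¹' {y})) : h (el y i) = y := by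
    rw [hel' y i hi]; exact hel y i hi
  refine ⟨{
    rank := fun x => e (h x) ⟨x, rfl⟩
    cnt := fun y => Nat.card (h ⁻¹' {y})
    el := el
    cnt_pos := fun y => by
      obtain ⟨x, hx⟩ := hs y
      have : Nonempty (h ⁻¹' {y}) := ⟨⟨x, hx⟩⟩
      exact Nat.card_pos
    rank_lt := fun x => (e (h x) ⟨x, rfl⟩).2
    map_el := hmap
    rank_el := fun y i hi => by
      have h2 : (⟨el y i, hmap y i hi⟩ : (h ⁻¹' {y} : Set X)) = (e y).symm ⟨i, hi⟩ :=
        Subtype.ext (hel' y i hi)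
      rw [hrank _ y (hmap y i hi), h2, Equiv.apply_symm_apply]
    el_rank := fun x => by
      rw [hel' _ _ (e (h x) ⟨x, rfl⟩).2, Fin.eta, Equiv.symm_apply_apply] },
    fun y => (hN y).2⟩

variable {J : Type*}

open Classical in
/-- Shift of the points of a ray `n` steps forward along the ray. -/
noncomputable def rayShift (r : ℕ → J) (n : ℕ) (j : J) : J :=
  if h : ∃ m, r m = j then r (h.choose + n) else j

open Classical in
/-- A left inverse of `rayShift`. -/
noncomputable def rayUnshift (r : ℕ → J) (n : ℕ) (j : J) : J :=
  if h : ∃ m, r m = j then r (h.choose - n) else j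

variable {r : ℕ → J}

theorem rayShift_ray (hr : Function.Injective r) (n m : ℕ) : rayShift r n (r m) = r (m + n) := by
  have h : ∃ k, r k = r m := ⟨m, rfl⟩
  rw [rayShift, dif_pos h, hr h.choose_spec]

theorem rayUnshift_ray (hr : Function.Injective r) (n m : ℕ) :
    rayUnshift r n (r m) = r (m - n) := by
  have h : ∃ k, r k = r m := ⟨m, rfl⟩
  rw [rayUnshift, dif_pos h, hr h.choose_spec]

theorem rayShift_of_notMem {j : J} (h : ∀ m, r m ≠ j) (n : ℕ) : rayShift r n j = j := by
  simp [rayShift, h]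

theorem rayUnshift_of_notMem {j : J} (h : ∀ m, r m ≠ j) (n : ℕ) : rayUnshift r n j = j := by
  simp [rayUnshift, h]

theorem rayUnshift_rayShift (hr : Function.Injective r) (n : ℕ) (j : J) :
    rayUnshift r n (rayShift r n j) = j := by
  by_cases h : ∃ m, r m = j
  · obtain ⟨m, rfl⟩ := h
    rw [rayShift_ray hr, rayUnshift_ray hr, Nat.add_sub_cancel]
  · push Not at h
    rw [rayShift_of_notMem h, rayUnshift_of_notMem h]

theorem rayShift_rayUnshift (hr : Function.Injective r) {n : ℕ} {j : J}
    (hj : ¬ ∃ m, m < n ∧ j = r m) : rayShift r n (rayUnshift r n j) = j := by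
  by_cases h : ∃ m, r m = j
  · obtain ⟨m, rfl⟩ := h
    have : n ≤ m := not_lt.1 fun h => hj ⟨m, h, rfl⟩
    rw [rayUnshift_ray hr, rayShift_ray hr, Nat.sub_add_cancel this]
  · push Not at h
    rw [rayUnshift_of_notMem h, rayShift_of_notMem h]

theorem rayShift_ne (hr : Function.Injective r) (n : ℕ) (j : J) :
    ¬ ∃ m, m < n ∧ rayShift r n j = r m := by
  rintro ⟨m, hm, h⟩
  by_cases h' : ∃ k, r k = j
  · obtain ⟨k, rfl⟩ := h'
    rw [rayShift_ray hr] at h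
    have := hr h
    omega
  · push Not at h'
    rw [rayShift_of_notMem h'] at h
    exact h' m h.symm

variable {T T' I : Type*} {h₀ : T → T'} {h : I → J}

/-- The number of siblings that are displaced to slots below the image of `v`. -/
def extraCount (E₀ : FiberEnum h₀) (E : FiberEnum h) : AltWord T I → ℕ
  | .top a => if E₀.rank a = 0 then E₀.cnt (h₀ a) - 1 else 0
  | .child _ i => if E.rank i = 0 then E.cnt (h i) - 1 else 0

/-- The sibling of `v` of rank `m` in the same fibre. -/
def sibling (E₀ : FiberEnum h₀) (E : FiberEnum h) : AltWord T I → ℕ → AltWord T I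
  | .top a, m => .top (E₀.el (h₀ a) m)
  | .child v i, m => .child v (E.el (h i) m)

/-- Rearranges the words over `T` and `I` as words over `T'` and `J`. Letters of rank zero are
mapped by `h`; the remaining ones are inserted below their sibling of rank zero, at an initial
segment of the ray `r`, whose points are shifted forward to make room. -/
noncomputable def hotel (E₀ : FiberEnum h₀) (E : FiberEnum h) (r : ℕ → J) :
    AltWord T I → AltWord T' J
  | .top a => if E₀.rank a = 0 then .top (h₀ a) else .child (.top (h₀ a)) (r (E₀.rank a - 1))
  | .child v i =>
    let t := AltWord.child (hotel E₀ E r v) (rayShift r (extraCount E₀ E v) (h i))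
    if E.rank i = 0 then t else .child t (r (E.rank i - 1))

open Classical in
/-- The inverse of `hotel`. -/
noncomputable def unhotel (E₀ : FiberEnum h₀) (E : FiberEnum h) (r : ℕ → J) :
    AltWord T' J → AltWord T I
  | .top b => .top (E₀.el b 0)
  | .child t j =>
    let v := unhotel E₀ E r t
    if H : ∃ m, m < extraCount E₀ E v ∧ j = r m then sibling E₀ E v (H.choose + 1)
    else .child v (E.el (rayUnshift r (extraCount E₀ E v) j) 0)

variable (E₀ : FiberEnum h₀) (E : FiberEnum h)

theorem unhotel_child_ray (hr : Function.Injective r) (t : AltWord T' J) {m : ℕ}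
    (hm : m < extraCount E₀ E (unhotel E₀ E r t)) :
    unhotel E₀ E r (.child t (r m)) = sibling E₀ E (unhotel E₀ E r t) (m + 1) := by
  have H : ∃ k, k < extraCount E₀ E (unhotel E₀ E r t) ∧ r m = r k := ⟨m, hm, rfl⟩
  rw [unhotel]
  rw [dif_pos H, hr H.choose_spec.2.symm]

theorem unhotel_child_shift (hr : Function.Injective r) (t : AltWord T' J) (j : J) :
    unhotel E₀ E r (.child t (rayShift r (extraCount E₀ E (unhotel E₀ E r t)) j)) =
      .child (unhotel E₀ E r t) (E.el j 0) := by
  rw [unhotel]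
  rw [dif_neg (rayShift_ne hr _ _), rayUnshift_rayShift hr]

theorem unhotel_hotel (hr : Function.Injective r) (v : AltWord T I) :
    unhotel E₀ E r (hotel E₀ E r v) = v := by
  induction v with
  | top a =>
    have hlt := E₀.rank_lt a
    rw [hotel]
    split_ifs with h0
    · have := E₀.el_rank a
      rw [h0] at this
      rw [unhotel, this]
    · have e : unhotel E₀ E r (.top (h₀ a)) = .top (E₀.el (h₀ a) 0) := rfl
      have hk : extraCount E₀ E (unhotel E₀ E r (.top (h₀ a))) = E₀.cnt (h₀ a) - 1 := by
        rw [e, extraCount, if_pos (E₀.rank_el _ _ (E₀.cnt_pos _)), E₀.map_el _ _ (E₀.cnt_pos _)]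
      rw [unhotel_child_ray E₀ E hr _ (by rw [hk]; omega), e, sibling,
        E₀.map_el _ _ (E₀.cnt_pos _), Nat.sub_add_cancel (by omega), E₀.el_rank]
  | child v i ih =>
    have hlt := E.rank_lt i
    have e : unhotel E₀ E r (.child (hotel E₀ E r v) (rayShift r (extraCount E₀ E v) (h i))) =
        .child v (E.el (h i) 0) := by
      have := unhotel_child_shift E₀ E hr (hotel E₀ E r v) (h i)
      rwa [ih] at this
    rw [hotel]
    split_ifs with h0
    · have := E.el_rank i
      rw [h0] at this
      rw [e, this]
    · have hk : extraCount E₀ E (.child v (E.el (h i) 0)) = E.cnt (h i) - 1 := by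
        rw [extraCount, if_pos (E.rank_el _ _ (E.cnt_pos _)), E.map_el _ _ (E.cnt_pos _)]
      rw [unhotel_child_ray E₀ E hr _ (by rw [e, hk]; omega), e, sibling,
        E.map_el _ _ (E.cnt_pos _), Nat.sub_add_cancel (by omega), E.el_rank]

theorem hotel_sibling (v : AltWord T I) {m : ℕ} (hm : m < extraCount E₀ E v) :
    hotel E₀ E r (sibling E₀ E v (m + 1)) = .child (hotel E₀ E r v) (r m) := by
  cases v with
  | top a =>
    rw [extraCount] at hm
    split_ifs at hm with h0
    · rw [sibling, hotel, hotel, if_pos h0, E₀.rank_el _ _ (by omega), E₀.map_el _ _ (by omega)]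
      simp
    · omega
  | child v i =>
    rw [extraCount] at hm
    split_ifs at hm with h0
    · rw [sibling, hotel, hotel]
      rw [if_pos h0, E.rank_el _ _ (by omega), E.map_el _ _ (by omega)]
      simp
    · omega

theorem hotel_unhotel (hr : Function.Injective r) (t : AltWord T' J) :
    hotel E₀ E r (unhotel E₀ E r t) = t := by
  induction t with
  | top b =>
    rw [unhotel, hotel, if_pos (E₀.rank_el _ _ (E₀.cnt_pos _)), E₀.map_el _ _ (E₀.cnt_pos _)]
  | child t j ih =>
    by_cases H : ∃ m, m < extraCount E₀ E (unhotel E₀ E r t) ∧ j = r m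
    · obtain ⟨m, hm, rfl⟩ := H
      rw [unhotel_child_ray E₀ E hr t hm, hotel_sibling E₀ E _ hm, ih]
    · rw [unhotel]
      rw [dif_neg H, hotel]
      rw [if_pos (E.rank_el _ _ (E.cnt_pos _)), E.map_el _ _ (E.cnt_pos _), ih,
        rayShift_rayUnshift hr H]

theorem extraCount_le {N : ℕ} (h₁ : ∀ y, E₀.cnt y ≤ N) (h₂ : ∀ y, E.cnt y ≤ N)
    (v : AltWord T I) : extraCount E₀ E v ≤ N := by
  cases v with
  | top a =>
    have := h₁ (h₀ a)
    rw [extraCount]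
    split_ifs <;> omega
  | child v i =>
    have := h₂ (h i)
    rw [extraCount]
    split_ifs <;> omega

end Hotel

section LiftedMaps

open Monoid.Coprod

variable {A B C : Type*} [Group A] [Group B] [Group C] {S : Set A} {T : Set B} {R : Set C}

theorem wordDist_inl_le (hS : Subgroup.closure S = ⊤) (hR : Subgroup.closure R = ⊤) (a b : A) :
    wordDist (coprodGens S R) (inl a) (inl b) ≤ wordDist S a b :=
  wordDist_map_le hS (closure_coprodGens hS hR) inl (fun s hs => .inl ⟨s, hs, rfl⟩) a b

theorem wordDist_inr_le (hS : Subgroup.closure S = ⊤) (hR : Subgroup.closure R = ⊤) (c d : C) :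
    wordDist (coprodGens S R) (inr c) (inr d) ≤ wordDist R c d :=
  wordDist_map_le hR (closure_coprodGens hS hR) inr (fun s hs => .inr ⟨s, hs, rfl⟩) c d

/-- The map of free products induced by a map of coset representatives. -/
noncomputable def liftMap (θ : CosetRep A C → CosetRep B C) (x : Monoid.Coprod A C) :
    Monoid.Coprod B C :=
  evalNF (Prod.map θ id ((normalForm A C).symm x))

theorem liftMap_evalNF (θ : CosetRep A C → CosetRep B C) (x : CosetRep A C × C) :
    liftMap θ (evalNF x) = evalNF (Prod.map θ id x) := by
  have : evalNF x = normalForm A C x := rfl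
  rw [liftMap, this, Equiv.symm_apply_apply]

theorem liftMap_liftMap {θ : CosetRep A C → CosetRep B C} {η : CosetRep B C → CosetRep A C}
    (h : Function.LeftInverse η θ) (x : Monoid.Coprod A C) : liftMap η (liftMap θ x) = x := by
  obtain ⟨⟨v, c⟩, rfl⟩ := evalNF_surjective x
  simp [liftMap_evalNF, h v]

/-- The map of block representatives induced by a map of coset representatives. -/
def BlockRep.map (θ : CosetRep A C → CosetRep B C) : BlockRep A C → BlockRep B C :=
  Option.map (Prod.map θ id)

/-- A map of coset representatives that coarsely acts as `m` on every coset of `A` induces a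
Lipschitz map of free products. -/
theorem liftMap_lipschitz (hS : Subgroup.closure S = ⊤) (hT : Subgroup.closure T = ⊤)
    (hR : Subgroup.closure R = ⊤) {θ : CosetRep A C → CosetRep B C} {m : A → B} {M : ℕ}
    (hm : ∀ a, ∀ s ∈ S, wordDist T (m a) (m (a * s)) ≤ M)
    (happ : ∀ q a, wordDist (coprodGens T R) (evalNF (Prod.map θ id (blockEquiv (q, a))))
      ((BlockRep.map θ q).eval * inl (m a)) ≤ M) (x y : Monoid.Coprod A C) :
    wordDist (coprodGens T R) (liftMap θ x) (liftMap θ y) ≤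
      (3 * M + 1) * wordDist (coprodGens S R) x y := by
  have hTR := closure_coprodGens hT hR
  refine wordDist_le_mul_of_generators (closure_coprodGens hS hR) hTR ?_ x y
  rintro x _ (⟨s, hs, rfl⟩ | ⟨s, hs, rfl⟩)
  · obtain ⟨n, rfl⟩ := evalNF_surjective x
    obtain ⟨⟨q, a⟩, rfl⟩ := blockEquiv.surjective n
    rw [evalNF_mul_inl, liftMap_evalNF, liftMap_evalNF]
    have h1 := happ q a
    have h2 := happ q (a * s)
    rw [wordDist_comm hTR] at h2
    have h3 := (wordDist_inl_le hT hR (m a) (m (a * s))).trans (hm a s hs)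
    rw [← wordDist_mul_left (BlockRep.map θ q).eval] at h3
    have h4 := wordDist_triangle hTR (evalNF (Prod.map θ id (blockEquiv (q, a))))
      ((BlockRep.map θ q).eval * inl (m a)) (evalNF (Prod.map θ id (blockEquiv (q, a * s))))
    have h5 := wordDist_triangle hTR ((BlockRep.map θ q).eval * inl (m a))
      ((BlockRep.map θ q).eval * inl (m (a * s)))
      (evalNF (Prod.map θ id (blockEquiv (q, a * s))))
    omega
  · obtain ⟨⟨v, c⟩, rfl⟩ := evalNF_surjective x
    rw [evalNF_mul_inr, liftMap_evalNF, liftMap_evalNF]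
    simp only [Prod.map_apply, id_eq]
    rw [← evalNF_mul_inr]
    exact (wordDist_mul_le_one _ (.inr ⟨s, hs, rfl⟩)).trans (by omega)

/-- A sequence of letters of which one component is constant and the other moves by steps of
length at most one. -/
def IsLetterRay (T : Set B) (R : Set C) (r : ℕ → Letter B C) : Prop :=
  (∃ b, ∀ m, (r m).2 = b ∧ wordDist R (r m).1.1 (r (m + 1)).1.1 ≤ 1) ∨
    ∃ c, ∀ m, (r m).1 = c ∧ wordDist T (r m).2.1 (r (m + 1)).2.1 ≤ 1

theorem exists_rayShift_bound (hS : Subgroup.closure S = ⊤) (hR : Subgroup.closure R = ⊤)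
    {r : ℕ → Letter B C} (hr : Function.Injective r) (hray : IsLetterRay T R r)
    {m : {b : B // b ≠ 1} → A} {K : ℕ}
    (hm : ∀ b b', wordDist S (m b) (m b') ≤ K * wordDist T b.1 b'.1 + K) (N : ℕ) :
    ∃ D : ℕ, ∀ n ≤ N, ∀ j, wordDist (coprodGens S R)
      (inr j.1.1 * inl (m j.2)) (inr (rayShift r n j).1.1 * inl (m (rayShift r n j).2)) ≤ D := by
  have hSR := closure_coprodGens hS hR
  obtain ⟨L, hL⟩ : ∃ L : ℕ, ∀ n, wordDist (coprodGens S R)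
      (inr (r n).1.1 * inl (m (r n).2)) (inr (r (n + 1)).1.1 * inl (m (r (n + 1)).2)) ≤ L := by
    rcases hray with ⟨b, hb⟩ | ⟨c, hc⟩
    · refine ⟨2 * wordDist (coprodGens S R) 1 (inl (m b)) + 1, fun n => ?_⟩
      rw [(hb n).1, (hb (n + 1)).1]
      have h1 := (wordDist_inr_le hS hR (r n).1.1 (r (n + 1)).1.1).trans (hb n).2
      have h2 := wordDist_mul_right_self (S := coprodGens S R) (inr (r n).1.1) (inl (m b))
      rw [wordDist_comm hSR] at h2
      have h3 := wordDist_mul_right_self (S := coprodGens S R) (inr (r (n + 1)).1.1) (inl (m b))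
      have h4 := wordDist_triangle hSR (inr (r n).1.1 * inl (m b)) (inr (r n).1.1)
        (inr (r (n + 1)).1.1 * inl (m b))
      have h5 := wordDist_triangle hSR (inr (r n).1.1) (inr (r (n + 1)).1.1)
        (inr (r (n + 1)).1.1 * inl (m b))
      omega
    · refine ⟨2 * K, fun n => ?_⟩
      rw [(hc n).1, (hc (n + 1)).1, wordDist_mul_left]
      refine (wordDist_inl_le hS hR _ _).trans ((hm _ _).trans ?_)
      have := Nat.mul_le_mul_left K (hc n).2
      omega
  have hL' (n k : ℕ) : wordDist (coprodGens S R) (inr (r k).1.1 * inl (m (r k).2))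
      (inr (r (k + n)).1.1 * inl (m (r (k + n)).2)) ≤ n * L := by
    induction n with
    | zero => simp [wordDist_self]
    | succ n ih =>
      refine (wordDist_triangle hSR _ _ _).trans ((Nat.add_le_add ih (hL (k + n))).trans ?_)
      rw [Nat.succ_mul]
  refine ⟨N * L, fun n hn j => ?_⟩
  by_cases h : ∃ k, r k = j
  · obtain ⟨k, rfl⟩ := h
    rw [rayShift_ray hr]
    exact (hL' n k).trans (Nat.mul_le_mul_right L hn)
  · push Not at h
    rw [rayShift_of_notMem h, wordDist_self]
    exact Nat.zero_le _

/-- An enumeration of the fibres of `g` gives one of the fibres of `Prod.map id g`. -/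
def FiberEnum.prodMap {X Y Z : Type*} {g : X → Y} (E : FiberEnum g) :
    FiberEnum (Prod.map (id : Z → Z) g) where
  rank x := E.rank x.2
  cnt y := E.cnt y.2
  el y i := (y.1, E.el y.2 i)
  cnt_pos y := E.cnt_pos y.2
  rank_lt x := E.rank_lt x.2
  map_el y i hi := Prod.ext rfl (E.map_el y.2 i hi)
  rank_el y i hi := E.rank_el y.2 i hi
  el_rank x := Prod.ext rfl (E.el_rank x.2)

theorem exists_bound_range (u : ℕ → ℕ) (N : ℕ) : ∃ D, ∀ m < N, u m ≤ D :=
  ⟨(Finset.range N).sup u, fun _ hm => Finset.le_sup (f := u) (Finset.mem_range.2 hm)⟩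

/-- A surjective coarse embedding, normalized to preserve and reflect nontriviality. -/
theorem exists_nontrivial_restriction [Nontrivial B] {f : A → B} (hf : Function.Surjective f)
    (hf1 : f 1 = 1) (T : Set B) : ∃ (g : {a : A // a ≠ 1} → {b : B // b ≠ 1}) (K₀ : ℕ),
      Function.Surjective g ∧ ∀ a, wordDist T (g a).1 (f a.1) ≤ K₀ := by
  classical
  obtain ⟨b₀, hb₀⟩ := exists_ne (1 : B)
  refine ⟨fun a => if h : f a.1 = 1 then ⟨b₀, hb₀⟩ else ⟨f a.1, h⟩, wordDist T b₀ 1, ?_, ?_⟩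
  · rintro ⟨b, hb⟩
    obtain ⟨a, rfl⟩ := hf b
    exact ⟨⟨a, fun h => hb (h ▸ hf1)⟩, by simp [hb]⟩
  · rintro ⟨a, ha⟩
    by_cases h : f a = 1
    · simp [h]
    · simp [h, wordDist_self]

variable {f : A → B} {g : {a : A // a ≠ 1} → {b : B // b ≠ 1}} {K K₀ K₁ D M N : ℕ}
  {r : ℕ → Letter B C}

theorem hotel_blockwise (hT : Subgroup.closure T = ⊤) (hR : Subgroup.closure R = ⊤)
    (hf1 : f 1 = 1) (hg : ∀ a, wordDist T (g a).1 (f a.1) ≤ K₀)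
    (E₀ : FiberEnum f) (E : FiberEnum g) (hE₀ : ∀ y, E₀.cnt y ≤ N) (hE : ∀ y, E.cnt y ≤ N)
    (hD : ∀ n ≤ N, ∀ j, wordDist (coprodGens T R) (Letter.eval j)
      (Letter.eval (rayShift r n j)) ≤ D)
    (hM : ∀ m < N, wordDist (coprodGens T R) 1 (Letter.eval (r m)) ≤ M)
    (q : BlockRep A C) (a : A) :
    wordDist (coprodGens T R)
      (evalNF (Prod.map (hotel E₀ E.prodMap r) id (blockEquiv (q, a))))
      ((BlockRep.map (hotel E₀ E.prodMap r) q).eval * inl (f a)) ≤ M + D + K₀ := by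
  have hTR := closure_coprodGens hT hR
  rcases q with _ | ⟨v, c⟩
  · have e : blockEquiv ((none : BlockRep A C), a) = (.top a, 1) := rfl
    have hlt := E₀.rank_lt a
    have := hE₀ (f a)
    rw [e]
    simp only [Prod.map_apply, id_eq, evalNF, map_one, mul_one, BlockRep.map, Option.map_none,
      BlockRep.eval, one_mul]
    rw [hotel]
    split_ifs with h0
    · simp [CosetRep.eval, wordDist_self]
    · rw [wordDist_comm hTR]
      simp only [CosetRep.eval]
      rw [wordDist_mul_right_self]
      exact (hM _ (by omega)).trans (by omega)
  · by_cases ha : a = 1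
    · subst ha
      have e : blockEquiv ((some (v, c) : BlockRep A C), (1 : A)) = (v, c.1) := by
        simp [blockEquiv, blockPoint]
      rw [e, hf1]
      simp [evalNF, BlockRep.map, BlockRep.eval, wordDist_self]
    · have e : blockEquiv ((some (v, c) : BlockRep A C), a) = (.child v (c, ⟨a, ha⟩), 1) := by
        simp [blockEquiv, blockPoint, ha]
      rw [e]
      simp only [Prod.map_apply, id_eq, evalNF, map_one, mul_one, BlockRep.map, Option.map_some,
        BlockRep.eval]
      set k := extraCount E₀ E.prodMap v
      have hk : k ≤ N := extraCount_le _ _ hE₀ (fun y => hE y.2) v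
      set w := CosetRep.eval (hotel E₀ E.prodMap r v)
      set j : Letter B C := (c, g ⟨a, ha⟩)
      have h1 : wordDist (coprodGens T R) (w * Letter.eval (rayShift r k j))
          (w * inr c.1 * inl (f a)) ≤ D + K₀ := by
        rw [mul_assoc, wordDist_mul_left]
        have e1 := hD k hk j
        rw [wordDist_comm hTR] at e1
        have e2 : wordDist (coprodGens T R) (Letter.eval j) (inr c.1 * inl (f a)) ≤ K₀ := by
          rw [Letter.eval, wordDist_mul_left]
          exact (wordDist_inl_le hT hR _ _).trans (hg ⟨a, ha⟩)
        exact (wordDist_triangle hTR _ _ _).trans (Nat.add_le_add e1 e2)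
      have hlt := E.rank_lt ⟨a, ha⟩
      have hle := hE (g ⟨a, ha⟩)
      rw [hotel]
      split_ifs with h0
      · exact h1.trans (by omega)
      · have h2 := hM (E.rank ⟨a, ha⟩ - 1) (by have h0' : E.rank ⟨a, ha⟩ ≠ 0 := h0; omega)
        rw [← wordDist_mul_right_self (w * Letter.eval (rayShift r k j)), wordDist_comm hTR] at h2
        have h3 := (wordDist_triangle hTR _ _ _).trans (Nat.add_le_add h2 h1)
        rw [← add_assoc] at h3
        exact h3

theorem sibling_dist (hS : Subgroup.closure S = ⊤) (hR : Subgroup.closure R = ⊤)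
    (E₀ : FiberEnum f) (E : FiberEnum g)
    (hf : ∀ a a', f a = f a' → wordDist S a a' ≤ K₁)
    (hg : ∀ a a', g a = g a' → wordDist S a.1 a'.1 ≤ K₁)
    (v : CosetRep A C) {m : ℕ} (hm : m < extraCount E₀ E.prodMap v) :
    wordDist (coprodGens S R) (CosetRep.eval (sibling E₀ E.prodMap v (m + 1)))
      (CosetRep.eval v) ≤ K₁ := by
  rcases v with a | ⟨v, c, a⟩
  · rw [extraCount] at hm
    split_ifs at hm with h0
    · simp only [sibling, CosetRep.eval]
      exact (wordDist_inl_le hS hR _ _).trans (hf _ _ (E₀.map_el _ _ (by omega)))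
    · omega
  · rw [extraCount] at hm
    split_ifs at hm with h0
    · simp only [sibling, CosetRep.eval, Letter.eval, FiberEnum.prodMap, Prod.map_apply, id_eq]
      rw [wordDist_mul_left, wordDist_mul_left]
      have hm' : m < E.cnt (g a) - 1 := hm
      exact (wordDist_inl_le hS hR _ _).trans (hg _ _ (E.map_el _ _ (by omega)))
    · omega

theorem unhotel_blockwise (hS : Subgroup.closure S = ⊤) (hR : Subgroup.closure R = ⊤)
    (hr : Function.Injective r) (E₀ : FiberEnum f) (E : FiberEnum g)
    (hE₀ : ∀ y, E₀.cnt y ≤ N) (hE : ∀ y, E.cnt y ≤ N) (hs1 : wordDist S 1 (E₀.el 1 0) ≤ K₁)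
    (hf : ∀ a a', f a = f a' → wordDist S a a' ≤ K₁)
    (hg : ∀ a a', g a = g a' → wordDist S a.1 a'.1 ≤ K₁)
    (hs : ∀ b, wordDist S (E.el b 0).1 (E₀.el b.1 0) ≤ K₁)
    (hD : ∀ n ≤ N, ∀ j : Letter B C, wordDist (coprodGens S R)
      (inr j.1.1 * inl (E.el j.2 0).1)
      (inr (rayShift r n j).1.1 * inl (E.el (rayShift r n j).2 0).1) ≤ D)
    (hM : ∀ m < N, wordDist (coprodGens S R) 1 (inr (r m).1.1 * inl (E₀.el (r m).2.1 0)) ≤ M)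
    (q : BlockRep B C) (b : B) :
    wordDist (coprodGens S R)
      (evalNF (Prod.map (unhotel E₀ E.prodMap r) id (blockEquiv (q, b))))
      ((BlockRep.map (unhotel E₀ E.prodMap r) q).eval * inl (E₀.el b 0)) ≤ M + D + K₁ := by
  have hSR := closure_coprodGens hS hR
  rcases q with _ | ⟨t, c⟩
  · have e : blockEquiv ((none : BlockRep B C), b) = (.top b, 1) := rfl
    rw [e]
    simp [evalNF, BlockRep.map, BlockRep.eval, unhotel, CosetRep.eval, wordDist_self]
  · by_cases hb : b = 1
    · subst hb
      have e : blockEquiv ((some (t, c) : BlockRep B C), (1 : B)) = (t, c.1) := by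
        simp [blockEquiv, blockPoint]
      rw [e]
      simp only [Prod.map_apply, id_eq, evalNF, BlockRep.map, Option.map_some, BlockRep.eval]
      rw [wordDist_mul_right_self]
      have h1 := wordDist_inl_le hS hR 1 (E₀.el 1 0)
      rw [map_one] at h1
      omega
    · have e : blockEquiv ((some (t, c) : BlockRep B C), b) = (.child t (c, ⟨b, hb⟩), 1) := by
        simp [blockEquiv, blockPoint, hb]
      rw [e]
      simp only [Prod.map_apply, id_eq, evalNF, map_one, mul_one, BlockRep.map, Option.map_some,
        BlockRep.eval]
      set v := unhotel E₀ E.prodMap r t with hv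
      have hk := extraCount_le E₀ E.prodMap hE₀ (fun y => hE y.2) v
      set j : Letter B C := (c, ⟨b, hb⟩) with hj
      by_cases H : ∃ m, m < extraCount E₀ E.prodMap v ∧ j = r m
      · obtain ⟨m, hm, hjm⟩ := H
        rw [hjm, unhotel_child_ray E₀ E.prodMap hr t hm, ← hv]
        have h1 := sibling_dist hS hR E₀ E hf hg v hm
        have h2 := hM m (by omega)
        rw [← hjm, ← wordDist_mul_right_self (CosetRep.eval v), ← mul_assoc] at h2
        exact (wordDist_triangle hSR _ _ _).trans ((Nat.add_le_add h1 h2).trans (by omega))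
      · have h1 := rayShift_rayUnshift hr H
        rw [← h1, unhotel_child_shift E₀ E.prodMap hr t, ← hv]
        have h2 := hD _ hk (rayUnshift r (extraCount E₀ E.prodMap v) j)
        rw [h1] at h2
        have h3 : wordDist (coprodGens S R) (inr j.1.1 * inl (E.el j.2 0).1)
            (inr c.1 * inl (E₀.el b 0)) ≤ K₁ := by
          rw [hj, wordDist_mul_left]
          exact (wordDist_inl_le hS hR _ _).trans (hs ⟨b, hb⟩)
        rw [mul_assoc, CosetRep.eval, wordDist_mul_left]
        exact (wordDist_triangle hSR _ _ _).trans ((Nat.add_le_add h2 h3).trans (by omega))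

/-- A surjective quasi-isometry `A → B` induces a quasi-isometry of free products with `C`, provided
there is room for a Hilbert hotel in `C` or in `B`. -/
theorem coarselyEquivalent_coprod_of_surjective [Nontrivial B] (hS : Subgroup.closure S = ⊤)
    (hT : Subgroup.closure T = ⊤) (hR : Subgroup.closure R = ⊤) (hfin : S.Finite)
    (hf : Function.Surjective f) (hf1 : f 1 = 1)
    (hK : ∀ a a', wordDist T (f a) (f a') ≤ K * wordDist S a a' + K)
    (hK' : ∀ a a', wordDist S a a' ≤ K * wordDist T (f a) (f a') + K)
    (hr : Function.Injective r) (hray : IsLetterRay T R r) :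
    CoarselyEquivalent (coprodGens S R) (coprodGens T R) := by
  obtain ⟨g, K₀, hgs, hg⟩ := exists_nontrivial_restriction hf hf1 T
  obtain ⟨K₁, hK₁⟩ : ∃ K₁, K₁ = K * (2 * K₀) + K := ⟨_, rfl⟩
  have hf' : ∀ a a', f a = f a' → wordDist S a a' ≤ K₁ := fun a a' h => by
    have := hK' a a'
    rw [h, wordDist_self] at this
    omega
  have hg' : ∀ a a', wordDist S a.1 a'.1 ≤ K * wordDist T (g a).1 (g a').1 + K₁ := fun a a' => by
    have h1 := hg a
    rw [wordDist_comm hT] at h1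
    have h2 := hg a'
    have h3 := wordDist_triangle hT (f a.1) (g a).1 (f a'.1)
    have h4 := wordDist_triangle hT (g a).1 (g a').1 (f a'.1)
    have h5 : wordDist T (f a.1) (f a'.1) ≤ wordDist T (g a).1 (g a').1 + 2 * K₀ := by omega
    have := (hK' a.1 a'.1).trans (Nat.add_le_add_right (Nat.mul_le_mul_left K h5) K)
    rw [mul_add] at this
    omega
  have hg'' : ∀ a a', g a = g a' → wordDist S a.1 a'.1 ≤ K₁ := fun a a' h => by
    have := hg' a a'
    rw [h, wordDist_self] at this
    omega
  obtain ⟨N, hN⟩ := exists_ncard_bound hS hfin K₁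
  obtain ⟨E₀, hE₀⟩ := exists_fiberEnum hf (N := N) fun y =>
    hN _ fun a ha a' ha' => hf' a a' (ha.trans ha'.symm)
  obtain ⟨E, hE⟩ := exists_fiberEnum hgs (N := N) fun y => by
    have h := hN (Subtype.val '' (g ⁻¹' {y})) (by
      rintro _ ⟨a, ha, rfl⟩ _ ⟨a', ha', rfl⟩
      exact hg'' a a' (ha.trans ha'.symm))
    rw [Set.ncard_image_of_injective _ Subtype.val_injective] at h
    exact ⟨h.1.of_finite_image Subtype.val_injective.injOn, h.2⟩
  have hgE (b) : g (E.el b 0) = b := E.map_el b 0 (E.cnt_pos b)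
  have hfE (b) : f (E₀.el b 0) = b := E₀.map_el b 0 (E₀.cnt_pos b)
  have hlip : ∀ b b', wordDist S (E.el b 0).1 (E.el b' 0).1 ≤ K₁ * wordDist T b.1 b'.1 + K₁ :=
    fun b b' => by
      have := hg' (E.el b 0) (E.el b' 0)
      rw [hgE, hgE] at this
      exact this.trans (Nat.add_le_add_right (Nat.mul_le_mul_right _ (by omega)) _)
  have hs : ∀ b, wordDist S (E.el b 0).1 (E₀.el b.1 0) ≤ K₁ := fun b => by
    have h1 := hK' (E.el b 0).1 (E₀.el b.1 0)
    have h2 := hg (E.el b 0)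
    rw [hgE, wordDist_comm hT] at h2
    rw [hfE] at h1
    have h3 := Nat.mul_le_mul_left K (show wordDist T (f (E.el b 0).1) b.1 ≤ 2 * K₀ by omega)
    omega
  have hs1 : wordDist S 1 (E₀.el 1 0) ≤ K₁ := hf' _ _ (by rw [hfE, hf1])
  obtain ⟨D₁, hD₁⟩ := exists_rayShift_bound hT hR hr hray (m := Subtype.val) (K := 1)
    (fun b b' => by omega) N
  obtain ⟨D₂, hD₂⟩ := exists_rayShift_bound hS hR hr hray
    (m := fun b => (E.el b 0).1) hlip N
  obtain ⟨M₁, hM₁⟩ := exists_bound_range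
    (fun m => wordDist (coprodGens T R) 1 (Letter.eval (r m))) N
  obtain ⟨M₂, hM₂⟩ := exists_bound_range
    (fun m => wordDist (coprodGens S R) 1 (inr (r m).1.1 * inl (E₀.el (r m).2.1 0))) N
  obtain ⟨Q, hQ⟩ : ∃ Q, Q = M₁ + D₁ + K₀ + (M₂ + D₂ + K₁) + 2 * K := ⟨_, rfl⟩
  refine ⟨liftMap (hotel E₀ E.prodMap r), liftMap (unhotel E₀ E.prodMap r), 3 * Q + 1,
    liftMap_lipschitz hS hT hR (m := f) (fun a s hs => ?_) (fun q a => ?_),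
    liftMap_lipschitz hT hS hR (m := fun b => E₀.el b 0) (fun b s hs => ?_) (fun q b => ?_),
    fun x => ?_, fun y => ?_⟩
  · have h1 := Nat.mul_le_mul_left K (wordDist_mul_le_one a hs)
    have h2 := hK a (a * s)
    omega
  · exact (hotel_blockwise hT hR hf1 hg E₀ E hE₀ hE hD₁ hM₁ q a).trans (by omega)
  · have h1 := Nat.mul_le_mul_left K (wordDist_mul_le_one b hs)
    have h2 := hK' (E₀.el b 0) (E₀.el (b * s) 0)
    rw [hfE, hfE] at h2
    omega
  · exact (unhotel_blockwise hS hR hr E₀ E hE₀ hE hs1 hf' hg'' hs hD₂ hM₂ q b).trans (by omega)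
  · rw [liftMap_liftMap (unhotel_hotel E₀ E.prodMap hr), wordDist_self]
    exact Nat.zero_le _
  · rw [liftMap_liftMap (hotel_unhotel E₀ E.prodMap hr), wordDist_self]
    exact Nat.zero_le _

end LiftedMaps

section BinaryCoding

open Monoid.Coprod

/-- Two binary strings, read from the right, that differ in at most `L` of their last letters. -/
def Near (L : ℕ) (x y : List Bool) : Prop :=
  ∃ l l' t, x = l ++ t ∧ y = l' ++ t ∧ l.length ≤ L ∧ l'.length ≤ L

/-- A group that is, up to bounded error, a binary tree. -/
def HasBinaryCoding {G : Type*} [Group G] (S : Set G) : Prop :=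
  ∃ (enc : G → List Bool) (dec : List Bool → G) (L : ℕ),
    (∀ x, ∀ s ∈ S, Near L (enc x) (enc (x * s))) ∧
    (∀ b t, wordDist S (dec (b :: t)) (dec t) ≤ L) ∧
    (∀ x, wordDist S (dec (enc x)) x ≤ L) ∧ ∀ y, Near L y (enc (dec y))

theorem wordDist_le_of_near {G : Type*} [Group G] {S : Set G} (hS : Subgroup.closure S = ⊤)
    {dec : List Bool → G} {L L' : ℕ} (h : ∀ b t, wordDist S (dec (b :: t)) (dec t) ≤ L)
    {x y : List Bool} (hxy : Near L' x y) : wordDist S (dec x) (dec y) ≤ 2 * (L' * L) := by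
  have key (l t : List Bool) : wordDist S (dec (l ++ t)) (dec t) ≤ l.length * L := by
    induction l with
    | nil => simp [wordDist_self]
    | cons b l ih =>
      rw [List.cons_append, List.length_cons, add_mul, one_mul]
      have := wordDist_triangle hS (dec (b :: (l ++ t))) (dec (l ++ t)) (dec t)
      have := h b (l ++ t)
      omega
  obtain ⟨l, l', t, rfl, rfl, hl, hl'⟩ := hxy
  have h1 := (key l t).trans (Nat.mul_le_mul_right L hl)
  have h2 := (key l' t).trans (Nat.mul_le_mul_right L hl')
  rw [wordDist_comm hS] at h2
  have := wordDist_triangle hS (dec (l ++ t)) (dec t) (dec (l' ++ t))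
  omega

theorem HasBinaryCoding.coarselyEquivalent {G H : Type*} [Group G] [Group H] {S : Set G}
    {T : Set H} (hS : Subgroup.closure S = ⊤) (hT : Subgroup.closure T = ⊤)
    (hG : HasBinaryCoding S) (hH : HasBinaryCoding T) : CoarselyEquivalent S T := by
  obtain ⟨enc, dec, L, h1, h2, h3, h4⟩ := hG
  obtain ⟨enc', dec', L', h1', h2', h3', h4'⟩ := hH
  refine ⟨fun x => dec' (enc x), fun y => dec (enc' y), 2 * (L * L') + 2 * (L' * L) + 2 * (L * L) +
    2 * (L' * L') + L + L', fun x y => ?_, fun x y => ?_, fun x => ?_, fun y => ?_⟩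
  · exact wordDist_le_mul_of_generators hS hT (f := fun x => dec' (enc x)) (fun x s hs =>
      (wordDist_le_of_near hT h2' (h1 x s hs)).trans (by omega)) x y
  · exact wordDist_le_mul_of_generators hT hS (f := fun x => dec (enc' x)) (fun x s hs =>
      (wordDist_le_of_near hS h2 (h1' x s hs)).trans (by omega)) x y
  · have e1 := wordDist_le_of_near hS h2 (h4' (enc x))
    rw [wordDist_comm hS] at e1
    have e2 := h3 x
    have e3 := wordDist_triangle hS (dec (enc' (dec' (enc x)))) (dec (enc x)) x
    beta_reduce
    omega
  · have e1 := wordDist_le_of_near hT h2' (h4 (enc' y))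
    rw [wordDist_comm hT] at e1
    have e2 := h3' y
    have e3 := wordDist_triangle hT (dec' (enc (dec (enc' y)))) (dec' (enc' y)) y
    beta_reduce
    omega

/-- A numbering of a finite alphabet with at least two letters. -/
structure LetterNumbering (T : Type*) where
  /-- The index of the last letter but one. -/
  last : ℕ
  /-- The letter with a given index. -/
  letter : ℕ → T
  /-- The index of a letter. -/
  index : T → ℕ
  index_le : ∀ a, index a ≤ last + 1
  letter_index : ∀ a, letter (index a) = a
  index_letter : ∀ i ≤ last + 1, index (letter i) = i

theorem nonempty_letterNumbering (T : Type*) [Finite T] [Nontrivial T] :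
    Nonempty (LetterNumbering T) := by
  have h := Finite.one_lt_card (α := T)
  obtain ⟨n, hn⟩ : ∃ n, Nat.card T = n + 2 := ⟨Nat.card T - 2, by omega⟩
  let e : T ≃ Fin (n + 2) := (Finite.equivFin T).trans (finCongr hn)
  exact ⟨⟨n, fun i => e.symm (Fin.ofNat (n + 2) i), fun a => (e a).1, fun a => by omega,
    fun a => by simp, fun i hi => by simp [Nat.mod_eq_of_lt (show i < n + 2 by omega)]⟩⟩

variable {T I : Type*} (τ : LetterNumbering T) (ι : LetterNumbering I)

namespace AltWord

/-- Append the letter with a given index. -/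
def extend : Option (AltWord T I) → ℕ → AltWord T I
  | none, i => .top (τ.letter i)
  | some v, i => .child v (ι.letter i)

/-- The index of the last letter but one among those that may be appended. -/
def lastIndex : Option (AltWord T I) → ℕ
  | none => τ.last
  | some _ => ι.last

/-- Decode a binary string, returning a word and the length of the incomplete block in front. -/
def decode : List Bool → Option (AltWord T I) × ℕ
  | [] => (none, 0)
  | false :: t => (some (extend τ ι (decode t).1 (decode t).2), 0)
  | true :: t =>
    if (decode t).2 < lastIndex τ ι (decode t).1 then ((decode t).1, (decode t).2 + 1)
    else (some (extend τ ι (decode t).1 ((decode t).2 + 1)), 0)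

/-- The block that encodes the letter of index `i` among `n + 2` letters. -/
def block (n i : ℕ) : List Bool :=
  if i ≤ n then false :: List.replicate i true else List.replicate (n + 1) true

theorem length_block_le (n i : ℕ) : (block n i).length ≤ n + 1 := by
  unfold block
  split_ifs with h <;> simp [h]

/-- The binary string encoding a word. -/
def encode : AltWord T I → List Bool
  | .top a => block τ.last (τ.index a)
  | .child v i => block ι.last (ι.index i) ++ encode v

theorem encode_extend (o : Option (AltWord T I)) {i : ℕ} (hi : i ≤ lastIndex τ ι o + 1) :
    encode τ ι (extend τ ι o i) = block (lastIndex τ ι o) i ++ o.elim [] (encode τ ι) := by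
  cases o with
  | none => simp [encode, extend, lastIndex, τ.index_letter i hi]
  | some v => simp [encode, extend, lastIndex, ι.index_letter i hi]

theorem decode_replicate {y : List Bool} {o : Option (AltWord T I)} (hy : decode τ ι y = (o, 0))
    {j : ℕ} (hj : j ≤ lastIndex τ ι o) :
    decode τ ι (List.replicate j true ++ y) = (o, j) := by
  induction j with
  | zero => simpa using hy
  | succ j ih =>
    rw [List.replicate_succ, List.cons_append, decode, ih (by omega), if_pos (by simpa using hj)]

theorem decode_block {y : List Bool} {o : Option (AltWord T I)} (hy : decode τ ι y = (o, 0))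
    {i : ℕ} (hi : i ≤ lastIndex τ ι o + 1) :
    decode τ ι (block (lastIndex τ ι o) i ++ y) = (some (extend τ ι o i), 0) := by
  unfold block
  split_ifs with h
  · rw [List.cons_append, decode, decode_replicate τ ι hy h]
  · rw [List.replicate_succ, List.cons_append, decode, decode_replicate τ ι hy le_rfl,
      if_neg (by simp), show i = lastIndex τ ι o + 1 by omega]

theorem decode_encode (v : AltWord T I) : decode τ ι (encode τ ι v) = (some v, 0) := by
  induction v with
  | top a =>
    have := decode_block τ ι (y := []) (o := none) rfl (τ.index_le a)
    simpa [extend, lastIndex, τ.letter_index, encode] using this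
  | child v i ih =>
    have := decode_block τ ι ih (ι.index_le i)
    simpa [extend, lastIndex, ι.letter_index, encode] using this

theorem eq_append_encode (y : List Bool) :
    (decode τ ι y).2 ≤ lastIndex τ ι (decode τ ι y).1 ∧
      y = List.replicate (decode τ ι y).2 true ++ (decode τ ι y).1.elim [] (encode τ ι) := by
  induction y with
  | nil => simp [decode]
  | cons b t ih =>
    rcases hd : decode τ ι t with ⟨o, j⟩
    rw [hd] at ih
    obtain ⟨h1, h2⟩ := ih
    dsimp only at h1 h2
    cases b with
    | false =>
      simp only [decode, hd]
      refine ⟨Nat.zero_le _, ?_⟩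
      rw [Option.elim_some, encode_extend τ ι _ (by omega), block, if_pos h1]
      exact congrArg _ h2
    | true =>
      by_cases h : j < lastIndex τ ι o
      · simp only [decode, hd, if_pos h]
        exact ⟨h, by rw [List.replicate_succ]; exact congrArg _ h2⟩
      · simp only [decode, hd, if_neg h]
        refine ⟨Nat.zero_le _, ?_⟩
        rw [Option.elim_some, encode_extend τ ι _ (by omega), block, if_neg (by omega),
          show lastIndex τ ι o = j by omega, List.replicate_succ]
        exact congrArg _ h2

end AltWord

/-- A free product of finite groups is a binary tree up to bounded error, unless both are of
order two. -/
theorem hasBinaryCoding_coprod {A C : Type*} [Group A] [Group C] [Finite A] [Finite C]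
    [Nontrivial A] [Nontrivial (Letter A C)] :
    HasBinaryCoding (coprodGens (Set.univ : Set A) (Set.univ : Set C)) := by
  obtain ⟨τ⟩ := nonempty_letterNumbering A
  obtain ⟨ι⟩ := nonempty_letterNumbering (Letter A C)
  have hS : Subgroup.closure (coprodGens (Set.univ : Set A) (Set.univ : Set C)) = ⊤ :=
    closure_coprodGens (by simp) (by simp)
  set S := coprodGens (Set.univ : Set A) (Set.univ : Set C)
  have hl (x : Monoid.Coprod A C) (a : A) : wordDist S x (x * inl a) ≤ 1 :=
    wordDist_mul_le_one x (.inl ⟨a, trivial, rfl⟩)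
  have hr (x : Monoid.Coprod A C) (c : C) : wordDist S x (x * inr c) ≤ 1 :=
    wordDist_mul_le_one x (.inr ⟨c, trivial, rfl⟩)
  let ev (o : Option (CosetRep A C)) : Monoid.Coprod A C := o.elim 1 CosetRep.eval
  have hev (o : Option (CosetRep A C)) (i : ℕ) :
      wordDist S (ev (some (AltWord.extend τ ι o i))) (ev o) ≤ 2 := by
    rw [wordDist_comm hS]
    cases o with
    | none =>
      have := hl 1 (τ.letter i)
      rw [one_mul] at this
      exact this.trans one_le_two
    | some v =>
      have h1 := hr v.eval (ι.letter i).1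
      have h2 := hl (v.eval * inr (ι.letter i).1.1) (ι.letter i).2
      have h3 := wordDist_triangle hS v.eval (v.eval * inr (ι.letter i).1.1)
        (v.eval * inr (ι.letter i).1.1 * inl (ι.letter i).2.1)
      have h4 := h3.trans (Nat.add_le_add h1 h2)
      rwa [mul_assoc] at h4
  have henc (q : BlockRep A C) : ∃ t, ∀ a, ∃ l : List Bool, l.length ≤ τ.last + ι.last + 2 ∧
      AltWord.encode τ ι (blockEquiv (q, a)).1 = l ++ t := by
    rcases q with _ | ⟨v, c⟩
    · refine ⟨[], fun a => ⟨_, ?_, (List.append_nil _).symm⟩⟩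
      have := AltWord.length_block_le τ.last (τ.index a)
      exact this.trans (by omega)
    · refine ⟨AltWord.encode τ ι v, fun a => ?_⟩
      by_cases h : a = 1
      · exact ⟨[], by simp, by simp [blockEquiv, blockPoint, h]⟩
      · refine ⟨AltWord.block ι.last (ι.index (c, ⟨a, h⟩)), ?_, by
          simp [blockEquiv, blockPoint, h, AltWord.encode]⟩
        have := AltWord.length_block_le ι.last (ι.index (c, ⟨a, h⟩))
        omega
  have hnf (x : CosetRep A C × C) : (normalForm A C).symm (evalNF x) = x :=
    (normalForm A C).symm_apply_apply x
  refine ⟨fun x => AltWord.encode τ ι ((normalForm A C).symm x).1,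
    fun y => ev (AltWord.decode τ ι y).1, τ.last + ι.last + 2, fun x s hs => ?_, fun b t => ?_,
    fun x => ?_, fun y => ?_⟩
  · obtain ⟨⟨v, c⟩, rfl⟩ := evalNF_surjective x
    rcases hs with ⟨s, -, rfl⟩ | ⟨s, -, rfl⟩
    · obtain ⟨⟨q, a⟩, hqa⟩ := blockEquiv.surjective (v, c)
      rw [← hqa, evalNF_mul_inl]
      simp only [hnf]
      obtain ⟨t, ht⟩ := henc q
      obtain ⟨l, hl, e⟩ := ht a
      obtain ⟨l', hl', e'⟩ := ht (a * s)
      exact ⟨l, l', t, e, e', hl, hl'⟩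
    · rw [evalNF_mul_inr]
      simp only [hnf]
      exact ⟨[], [], _, rfl, rfl, by simp, by simp⟩
  · cases b with
    | false => exact (hev _ _).trans (by omega)
    | true =>
      by_cases h : (AltWord.decode τ ι t).2 < AltWord.lastIndex τ ι (AltWord.decode τ ι t).1
      · simp only [AltWord.decode, if_pos h, wordDist_self]
        exact Nat.zero_le _
      · simp only [AltWord.decode, if_neg h]
        exact (hev _ _).trans (by omega)
  · obtain ⟨⟨v, c⟩, rfl⟩ := evalNF_surjective x
    simp only [hnf, AltWord.decode_encode]
    exact (hr v.eval c).trans (by omega)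
  · obtain ⟨h1, h2⟩ := AltWord.eq_append_encode τ ι y
    rcases hd : AltWord.decode τ ι y with ⟨o, j⟩
    rw [hd] at h1 h2
    have hlen := AltWord.length_block_le τ.last (τ.index 1)
    cases o with
    | none =>
      have hj : j ≤ τ.last := h1
      refine ⟨y, AltWord.encode τ ι (.top 1 : CosetRep A C), [], by simp, ?_, ?_, ?_⟩
      · have : ev none = evalNF ((.top 1 : CosetRep A C), (1 : C)) := by
          simp [ev, evalNF, CosetRep.eval]
        simp only [hd, this, hnf, List.append_nil]
      · rw [h2]
        simp only [Option.elim_none, List.append_nil, List.length_replicate]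
        omega
      · exact hlen.trans (by omega)
    | some v =>
      have hj : j ≤ ι.last := h1
      refine ⟨List.replicate j true, [], AltWord.encode τ ι v, h2, ?_, by simp; omega, by simp⟩
      have : ev (some v) = evalNF (v, (1 : C)) := by simp [ev, evalNF]
      simp only [hd, this, hnf, List.nil_append]

end BinaryCoding

section FreeProducts

variable {A B C : Type*} [Group A] [Group B] [Group C] {S : Set A} {T : Set B} {R : Set C}

theorem exists_letterRay [Nontrivial B] [Nontrivial C] (hT : Subgroup.closure T = ⊤)
    (hR : Subgroup.closure R = ⊤) (hTf : T.Finite) (hRf : R.Finite)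
    (h : Infinite B ∨ Infinite C) :
    ∃ r : ℕ → Letter B C, Function.Injective r ∧ IsLetterRay T R r := by
  rcases h with h | h
  · obtain ⟨ρ, hρ⟩ := exists_geodesic_ray hT hTf
    obtain ⟨c, hc⟩ := exists_ne (1 : C)
    refine ⟨fun m => (⟨c, hc⟩, ⟨ρ (m + 1), fun e => ?_⟩), fun m n e => ?_,
      .inr ⟨⟨c, hc⟩, fun m => ⟨rfl, (hρ (m + 1)).2⟩⟩⟩
    · have := (hρ (m + 1)).1
      rw [e, wordDist_self] at this
      omega
    · have h1 := (hρ (m + 1)).1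
      rw [show ρ (m + 1) = ρ (n + 1) from congrArg (fun x : Letter B C => x.2.1) e,
        (hρ (n + 1)).1] at h1
      omega
  · obtain ⟨ρ, hρ⟩ := exists_geodesic_ray hR hRf
    obtain ⟨b, hb⟩ := exists_ne (1 : B)
    refine ⟨fun m => (⟨ρ (m + 1), fun e => ?_⟩, ⟨b, hb⟩), fun m n e => ?_,
      .inl ⟨⟨b, hb⟩, fun m => ⟨rfl, (hρ (m + 1)).2⟩⟩⟩
    · have := (hρ (m + 1)).1
      rw [e, wordDist_self] at this
      omega
    · have h1 := (hρ (m + 1)).1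
      rw [show ρ (m + 1) = ρ (n + 1) from congrArg (fun x : Letter B C => x.1.1) e,
        (hρ (n + 1)).1] at h1
      omega

section ProdFinite

variable {M : Type*} [Group M]

theorem closure_insert_one_prod (hS : Subgroup.closure S = ⊤) :
    Subgroup.closure (insert 1 S ×ˢ (Set.univ : Set M)) = ⊤ := by
  rw [Subgroup.closure_prod (Set.mem_insert _ _) (Set.mem_univ _), Subgroup.closure_insert_one, hS,
    Subgroup.closure_univ, Subgroup.top_prod_top]

theorem wordDist_fst_le (hS : Subgroup.closure S = ⊤) (x y : A × M) :
    wordDist S x.1 y.1 ≤ wordDist (insert 1 S ×ˢ (Set.univ : Set M)) x y := by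
  have := wordDist_le_mul_of_generators (K := 1) (closure_insert_one_prod hS) hS
    (f := (Prod.fst : A × M → A)) (fun x s hs => ?_) x y
  · rwa [one_mul] at this
  · rcases hs.1 with h | h
    · simp [h, wordDist_self]
    · exact wordDist_mul_le_one _ h

theorem wordDist_prod_le (hS : Subgroup.closure S = ⊤) (x y : A × M) :
    wordDist (insert 1 S ×ˢ (Set.univ : Set M)) x y ≤ wordDist S x.1 y.1 + 1 := by
  obtain ⟨a, z⟩ := x
  obtain ⟨a', z'⟩ := y
  have hS' := closure_insert_one_prod (M := M) hS
  have h1 := wordDist_le_mul_of_generators (K := 1) hS hS' (f := fun a => (a, z))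
    (fun a s hs => by
      have := wordDist_mul_le_one (S := insert 1 S ×ˢ (Set.univ : Set M)) (a, z)
        (s := (s, 1)) ⟨.inr hs, trivial⟩
      simpa using this) a a'
  have h2 := wordDist_mul_le_one (S := insert 1 S ×ˢ (Set.univ : Set M)) (a', z)
    (s := (1, z⁻¹ * z')) ⟨.inl rfl, trivial⟩
  rw [Prod.mk_mul_mk, mul_one, mul_inv_cancel_left] at h2
  have h3 := wordDist_triangle hS' (a, z) (a', z) (a', z')
  rw [one_mul] at h1
  dsimp only at *
  omega

end ProdFinite

/-- A quasi-isometry becomes surjective after multiplying the domain by a finite group. -/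
theorem exists_surjective_prod_finite (hS : Subgroup.closure S = ⊤) (hT : Subgroup.closure T = ⊤)
    (hTf : T.Finite) {f : A → B} {K : ℕ}
    (hK : ∀ a a', wordDist T (f a) (f a') ≤ K * wordDist S a a' + K)
    (hK' : ∀ a a', wordDist S a a' ≤ K * wordDist T (f a) (f a') + K)
    (hd : ∀ b, ∃ a, wordDist T (f a) b ≤ K) :
    ∃ (k : ℕ) (F : A × Multiplicative (ZMod (k + 1)) → B) (K' : ℕ),
      Function.Surjective F ∧ F 1 = 1 ∧
      (∀ x y, wordDist T (F x) (F y) ≤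
        K' * wordDist (insert 1 S ×ˢ (Set.univ : Set (Multiplicative (ZMod (k + 1))))) x y + K') ∧
      ∀ x y, wordDist (insert 1 S ×ˢ (Set.univ : Set (Multiplicative (ZMod (k + 1))))) x y ≤
        K' * wordDist T (F x) (F y) + K' := by
  have hfin := (finite_wordDist_le hT hTf K).to_subtype
  have hne : Nonempty {b : B | wordDist T 1 b ≤ K} := ⟨1, by simp [wordDist_self]⟩
  obtain ⟨k, hk⟩ : ∃ k, Nat.card {b : B | wordDist T 1 b ≤ K} = k + 1 :=
    ⟨_, (Nat.succ_pred_eq_of_pos Nat.card_pos).symm⟩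
  let e : {b : B | wordDist T 1 b ≤ K} ≃ Multiplicative (ZMod (k + 1)) :=
    ((Finite.equivFin _).trans (finCongr hk)).trans Multiplicative.ofAdd
  have ht (z) : wordDist T 1 (e.symm z).1 ≤ K := (e.symm z).2
  have key (x y : A × Multiplicative (ZMod (k + 1))) :
      wordDist T ((f 1 * (e.symm 1).1)⁻¹ * (f x.1 * (e.symm x.2).1))
          ((f 1 * (e.symm 1).1)⁻¹ * (f y.1 * (e.symm y.2).1)) ≤
        wordDist T (f x.1) (f y.1) + 2 * K ∧
      wordDist T (f x.1) (f y.1) ≤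
        wordDist T ((f 1 * (e.symm 1).1)⁻¹ * (f x.1 * (e.symm x.2).1))
          ((f 1 * (e.symm 1).1)⁻¹ * (f y.1 * (e.symm y.2).1)) + 2 * K := by
    rw [wordDist_mul_left]
    have h1 := ht x.2
    have h2 := ht y.2
    rw [← wordDist_mul_right_self (f x.1)] at h1
    rw [← wordDist_mul_right_self (f y.1)] at h2
    have h3 := wordDist_comm hT (f x.1) (f x.1 * (e.symm x.2).1)
    have h4 := wordDist_comm hT (f y.1) (f y.1 * (e.symm y.2).1)
    have h5 := wordDist_triangle hT (f x.1 * (e.symm x.2).1) (f x.1) (f y.1 * (e.symm y.2).1)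
    have h6 := wordDist_triangle hT (f x.1) (f y.1) (f y.1 * (e.symm y.2).1)
    have h7 := wordDist_triangle hT (f x.1) (f x.1 * (e.symm x.2).1) (f y.1)
    have h8 := wordDist_triangle hT (f x.1 * (e.symm x.2).1) (f y.1 * (e.symm y.2).1) (f y.1)
    omega
  refine ⟨k, fun x => (f 1 * (e.symm 1).1)⁻¹ * (f x.1 * (e.symm x.2).1),
    K + K * (2 * K) + 2 * K + 1, fun b => ?_, ?_, fun x y => ?_, fun x y => ?_⟩
  · obtain ⟨a, ha⟩ := hd (f 1 * (e.symm 1).1 * b)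
    have ha' : wordDist T 1 ((f a)⁻¹ * (f 1 * (e.symm 1).1 * b)) ≤ K := by
      rwa [← wordDist_mul_right_self (f a), mul_inv_cancel_left]
    exact ⟨(a, e ⟨_, ha'⟩), by simp [mul_assoc]⟩
  · simp
  · have h1 := hK x.1 y.1
    have h2 := (key x y).1
    have h3 := Nat.mul_le_mul_left K (wordDist_fst_le (M := Multiplicative (ZMod (k + 1))) hS x y)
    beta_reduce
    simp only [add_mul]
    omega
  · have h1 := hK' x.1 y.1
    have h2 := Nat.mul_le_mul_left K (key x y).2
    have h3 := wordDist_prod_le (M := Multiplicative (ZMod (k + 1))) hS x y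
    rw [mul_add] at h2
    beta_reduce
    simp only [add_mul]
    omega

theorem coarselyEquivalent_coprod_of_infinite [Nontrivial A] [Nontrivial B] [Nontrivial C]
    (hS : Subgroup.closure S = ⊤) (hT : Subgroup.closure T = ⊤) (hR : Subgroup.closure R = ⊤)
    (hSf : S.Finite) (hTf : T.Finite) (hRf : R.Finite) {f : A → B} {K : ℕ}
    (hK : ∀ a a', wordDist T (f a) (f a') ≤ K * wordDist S a a' + K)
    (hK' : ∀ a a', wordDist S a a' ≤ K * wordDist T (f a) (f a') + K)
    (hd : ∀ b, ∃ a, wordDist T (f a) b ≤ K) (hA : Infinite A ∨ Infinite C)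
    (hB : Infinite B ∨ Infinite C) : CoarselyEquivalent (coprodGens S R) (coprodGens T R) := by
  obtain ⟨k, F, K', hF, hF1, h1, h2⟩ := exists_surjective_prod_finite hS hT hTf hK hK' hd
  obtain ⟨r, hr, hr'⟩ := exists_letterRay hS hR hSf hRf hA
  obtain ⟨ρ, hρ, hρ'⟩ := exists_letterRay hT hR hTf hRf hB
  have hU := closure_insert_one_prod (M := Multiplicative (ZMod (k + 1))) hS
  have hUf : (insert 1 S ×ˢ (Set.univ : Set (Multiplicative (ZMod (k + 1))))).Finite :=
    (hSf.insert 1).prod Set.finite_univ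
  have e1 := coarselyEquivalent_coprod_of_surjective hU hS hR hUf (K := 1) Prod.fst_surjective rfl
    (fun x y => by have := wordDist_fst_le hS x y; omega)
    (fun x y => by have := wordDist_prod_le hS x y; omega) hr hr'
  have e2 := coarselyEquivalent_coprod_of_surjective hU hT hR hUf hF hF1 h1 h2 hρ hρ'
  exact e1.symm.trans (closure_coprodGens hS hR) (closure_coprodGens hT hR) e2

theorem nontrivial_ne_one [Nontrivial C] (h : Nat.card C ≠ 2) : Nontrivial {c : C // c ≠ 1} := by
  obtain ⟨c, hc⟩ := exists_ne (1 : C)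
  by_contra h'
  rw [not_nontrivial_iff_subsingleton] at h'
  refine h (Nat.card_eq_two_iff.2 ⟨1, c, hc.symm, Set.eq_univ_of_forall fun x => ?_⟩)
  by_cases hx : x = 1
  · exact .inl hx
  · exact .inr (congrArg Subtype.val (Subsingleton.elim (⟨x, hx⟩ : {c : C // c ≠ 1}) ⟨c, hc⟩))

theorem nontrivial_letter [Nontrivial A] [Nontrivial C]
    (h : ¬ (Nat.card C = 2 ∧ Nat.card A = 2)) : Nontrivial (Letter A C) := by
  have hA : Nonempty {a : A // a ≠ 1} := nonempty_subtype.2 (exists_ne 1)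
  have hC : Nonempty {c : C // c ≠ 1} := nonempty_subtype.2 (exists_ne 1)
  by_cases hc : Nat.card C = 2
  · have := nontrivial_ne_one fun ha => h ⟨hc, ha⟩
    exact nontrivial_prod_right
  · have := nontrivial_ne_one hc
    exact nontrivial_prod_left

theorem CoarselyEquivalent.quasiIsometricGroups_of_finite (hS : Subgroup.closure S = ⊤)
    (hT : Subgroup.closure T = ⊤) (hSf : S.Finite) (hTf : T.Finite) (h : CoarselyEquivalent S T) :
    QuasiIsometricGroups A B := by
  lift S to Finset A using hSf
  lift T to Finset B using hTf
  exact h.quasiIsometricGroups hS hT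

theorem finite_coprodGens (hS : S.Finite) (hR : R.Finite) : (coprodGens S R).Finite :=
  (hS.image _).union (hR.image _)

theorem quasiIsometricGroups_coprod_of_finite [Finite A] [Finite B] [Finite C] [Nontrivial A]
    [Nontrivial B] [Nontrivial C] (hA : ¬ (Nat.card C = 2 ∧ Nat.card A = 2))
    (hB : ¬ (Nat.card C = 2 ∧ Nat.card B = 2)) :
    QuasiIsometricGroups (Monoid.Coprod A C) (Monoid.Coprod B C) := by
  have := nontrivial_letter hA
  have := nontrivial_letter hB
  have hS : Subgroup.closure (coprodGens (Set.univ : Set A) (Set.univ : Set C)) = ⊤ :=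
    closure_coprodGens (by simp) (by simp)
  have hT : Subgroup.closure (coprodGens (Set.univ : Set B) (Set.univ : Set C)) = ⊤ :=
    closure_coprodGens (by simp) (by simp)
  exact (hasBinaryCoding_coprod.coarselyEquivalent hS hT
    hasBinaryCoding_coprod).quasiIsometricGroups_of_finite hS hT
    (finite_coprodGens Set.finite_univ Set.finite_univ)
    (finite_coprodGens Set.finite_univ Set.finite_univ)

theorem QuasiIsometricGroups.exists_nat_bounds (h : QuasiIsometricGroups A B) :
    ∃ (S : Set A) (T : Set B) (f : A → B) (K : ℕ), S.Finite ∧ T.Finite ∧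
      Subgroup.closure S = ⊤ ∧ Subgroup.closure T = ⊤ ∧
      (∀ a a', wordDist T (f a) (f a') ≤ K * wordDist S a a' + K) ∧
      (∀ a a', wordDist S a a' ≤ K * wordDist T (f a) (f a') + K) ∧
      ∀ b, ∃ a, wordDist T (f a) b ≤ K := by
  obtain ⟨S, T, hS, hT, K, C, f, hK, hC, hf, hd⟩ := h
  obtain ⟨N, hN⟩ := exists_nat_ge (K + C + K * C)
  have hKC := mul_nonneg hK.le hC
  refine ⟨S, T, f, N, S.finite_toSet, T.finite_toSet, hS, hT, fun a a' => ?_, fun a a' => ?_,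
    fun b => ?_⟩
  · have h1 := (hf a a').2
    have h2 := Nat.cast_nonneg (α := ℝ) (wordDist (S : Set A) a a')
    have h3 : (wordDist (T : Set B) (f a) (f a') : ℝ) ≤ N * wordDist (S : Set A) a a' + N := by
      dsimp only at h1
      nlinarith
    exact_mod_cast h3
  · have h1 := (hf a a').1
    have h2 := Nat.cast_nonneg (α := ℝ) (wordDist (T : Set B) (f a) (f a'))
    rw [sub_le_iff_le_add, one_div, inv_mul_le_iff₀ hK] at h1
    have h3 : (wordDist (S : Set A) a a' : ℝ) ≤ N * wordDist (T : Set B) (f a) (f a') + N := by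
      dsimp only at h1
      nlinarith
    exact_mod_cast h3
  · obtain ⟨a, ha⟩ := hd b
    refine ⟨a, ?_⟩
    have h3 : (wordDist (T : Set B) (f a) b : ℝ) ≤ N := by
      dsimp only at ha
      linarith
    exact_mod_cast h3

theorem finite_iff_of_bounds (hS : Subgroup.closure S = ⊤) (hT : Subgroup.closure T = ⊤)
    (hSf : S.Finite) (hTf : T.Finite) {f : A → B} {K : ℕ}
    (hK : ∀ a a', wordDist T (f a) (f a') ≤ K * wordDist S a a' + K)
    (hK' : ∀ a a', wordDist S a a' ≤ K * wordDist T (f a) (f a') + K)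
    (hd : ∀ b, ∃ a, wordDist T (f a) b ≤ K) : Finite A ↔ Finite B := by
  constructor <;> intro
  · obtain ⟨k, F, -, hF, -⟩ := exists_surjective_prod_finite hS hT hTf hK hK' hd
    exact .of_surjective F hF
  · obtain ⟨n, hn⟩ := (Set.finite_range fun b => wordDist T (f 1) b).bddAbove
    refine Set.finite_univ_iff.1 ((finite_wordDist_le hS hSf (K * n + K)).subset fun a _ => ?_)
    have := Nat.mul_le_mul_left K (show wordDist T (f 1) (f a) ≤ n from hn ⟨f a, rfl⟩)
    exact (hK' 1 a).trans (by omega)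

end FreeProducts

/-- **Theorem 1 (Free products).** Let `A`, `B` and `C` be nontrivial finitely
generated groups.  If `A` and `B` are quasi-isometric then `A * C` and `B * C`
are quasi-isometric, unless `C`, and one of `A` or `B`, are of order 2. -/
theorem free_products_quasiIsometric (A B C : Type) [Group A] [Group B] [Group C]
    [Group.FG A] [Group.FG B] [Group.FG C]
    (hA : Nontrivial A) (hB : Nontrivial B) (hC : Nontrivial C)
    (hAB : QuasiIsometricGroups A B)
    (h2 : ¬ (Nat.card C = 2 ∧ (Nat.card A = 2 ∨ Nat.card B = 2))) :
    QuasiIsometricGroups (Monoid.Coprod A C) (Monoid.Coprod B C) := by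
  obtain ⟨S, T, f, K, hSf, hTf, hS, hT, hK, hK', hd⟩ := hAB.exists_nat_bounds
  obtain ⟨R, hR⟩ := Group.FG.out (G := C)
  have hiff := finite_iff_of_bounds hS hT hSf hTf hK hK' hd
  by_cases h : Infinite C ∨ Infinite A
  · have hA' : Infinite A ∨ Infinite C := h.symm
    have hB' : Infinite B ∨ Infinite C := by
      rwa [← not_finite_iff_infinite, ← hiff, not_finite_iff_infinite]
    exact (coarselyEquivalent_coprod_of_infinite hS hT hR hSf hTf R.finite_toSet hK hK' hd hA'
      hB').quasiIsometricGroups_of_finite (closure_coprodGens hS hR) (closure_coprodGens hT hR)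
      (finite_coprodGens hSf R.finite_toSet) (finite_coprodGens hTf R.finite_toSet)
  · simp only [not_or, not_infinite_iff_finite] at h
    have := h.1
    have := h.2
    have := hiff.1 h.2
    exact quasiIsometricGroups_coprod_of_finite (fun h' => h2 ⟨h'.1, .inl h'.2⟩)
      fun h' => h2 ⟨h'.1, .inr h'.2⟩
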